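/- Let p be an odd prime, G = C × H where C ≅ C₄ and H ≅ C_p × C_p, K ∈ Sup₂^min(G_r), and 𝒜 = V(K,G). If both C and H are 𝒜-subgroups, then 𝒜 = 𝒜_C ⊗ 𝒜_H; in particular, 𝒜 is the tensor product of two S-rings over proper nontrivial subgroups of G. -/

import Mathlib

open scoped Pointwise

noncomputable section

namespace Paper

/-- The element `∑_{x ∈ X} x` of the integer group ring `ℤG`. -/
def sumElems {G : Type*} [Group G] [Finite G] (X : Set G) : MonoidAlgebra ℤ G :=
  ∑ x ∈ X.toFinite.toFinset, MonoidAlgebra.single x (1 : ℤ)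

/-- A Schur ring (S-ring) over a finite group `G`, described by the partition of `G`
into its basic sets: the partition contains `{1}`, is closed under taking inverses,
and its `ℤ`-span inside the group ring `ℤG` is closed under multiplication
(hence is a subring of `ℤG`). -/
structure SRing (G : Type*) [Group G] [Finite G] where
  basic : Set (Set G)
  nonempty : ∀ X ∈ basic, X.Nonempty
  cover : ∀ g : G, ∃! X, X ∈ basic ∧ g ∈ X
  one_mem : ({1} : Set G) ∈ basic
  inv_mem : ∀ X ∈ basic, X⁻¹ ∈ basic
  mul_mem : ∀ a b : MonoidAlgebra ℤ G,
    a ∈ Submodule.span ℤ (sumElems '' basic) →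
    b ∈ Submodule.span ℤ (sumElems '' basic) →
    a * b ∈ Submodule.span ℤ (sumElems '' basic)

namespace SRing

/-- The `ℤ`-module underlying an S-ring. -/
def span {G : Type*} [Group G] [Finite G] (A : SRing G) :
    Submodule ℤ (MonoidAlgebra ℤ G) :=
  Submodule.span ℤ (sumElems '' A.basic)

/-- A set `X ⊆ G` is an `𝒜`-set if `∑_{x ∈ X} x ∈ 𝒜`. -/
def IsASet {G : Type*} [Group G] [Finite G] (A : SRing G) (X : Set G) : Prop :=
  sumElems X ∈ A.span

/-- A subgroup which is an `𝒜`-set is an `𝒜`-subgroup. -/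
def IsASubgroup {G : Type*} [Group G] [Finite G] (A : SRing G) (H : Subgroup G) : Prop :=
  A.IsASet (H : Set G)

end SRing

/-- The arc set `R(X) = {(g, xg) : x ∈ X, g ∈ G}` of the Cayley digraph `Cay(G, X)`. -/
def Rel {G : Type*} [Group G] (X : Set G) : Set (G × G) := {p | p.2 * p.1⁻¹ ∈ X}

/-- `f : G ≃ G'` is an isomorphism from the S-ring `A` over `G` to the S-ring `B`
over `G'` if `{R(X)^f : X ∈ 𝒮(A)} = {R(Y) : Y ∈ 𝒮(B)}`. -/
def IsSRingIso {G G' : Type*} [Group G] [Finite G] [Group G'] [Finite G']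
    (A : SRing G) (B : SRing G') (f : G ≃ G') : Prop :=
  (fun X => Prod.map f f '' Rel X) '' A.basic = Rel '' B.basic

/-- The automorphism group `Aut(𝒜)` of an S-ring, as a set of permutations of `G`. -/
def SRing.autSet {G : Type*} [Group G] [Finite G] (A : SRing G) : Set (Equiv.Perm G) :=
  {f | ∀ X ∈ A.basic, Prod.map f f '' Rel X = Rel X}

/-- The set `Iso(𝒜)` of isomorphisms from `𝒜` onto S-rings over the same group `G`. -/
def SRing.isoSet {G : Type*} [Group G] [Finite G] (A : SRing G) : Set (Equiv.Perm G) :=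
  {f | ∃ B : SRing G, IsSRingIso A B f}

/-- `Aut(G)` as a set of permutations of `G`. -/
def autPerm (G : Type*) [Group G] : Set (Equiv.Perm G) :=
  Set.range fun φ : G ≃* G => (φ.toEquiv : Equiv.Perm G)

/-- A CI-S-ring: `Aut(𝒜)·Aut(G) = Iso(𝒜)`. -/
def SRing.IsCI {G : Type*} [Group G] [Finite G] (A : SRing G) : Prop :=
  A.autSet * autPerm G = A.isoSet

/-- The orbits on `G` of a set of automorphisms of `G`. -/
def setOrbits {G : Type*} [Group G] (Δ : Set (MulAut G)) : Set (Set G) :=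
  Set.range fun g : G => (fun φ : MulAut G => φ g) '' Δ

/-- An S-ring is cyclotomic if its basic sets are exactly the orbits of some
subgroup `K ≤ Aut(G)`. -/
def SRing.IsCyclotomic {G : Type*} [Group G] [Finite G] (A : SRing G) : Prop :=
  ∃ K : Subgroup (MulAut G), A.basic = setOrbits (K : Set (MulAut G))

/-- `Aut_G(𝒜) = Aut(𝒜) ∩ Aut(G)`, as a set of automorphisms of `G`. -/
def SRing.autGSet {G : Type*} [Group G] [Finite G] (A : SRing G) : Set (MulAut G) :=
  {φ | (φ.toEquiv : Equiv.Perm G) ∈ A.autSet}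

/-- A (cyclotomic) S-ring is Cayley minimal if `Aut_G(𝒜)` is the only subgroup of
`Aut(G)` whose orbits on `G` coincide with those of `Aut_G(𝒜)`. -/
def SRing.IsCayleyMinimal {G : Type*} [Group G] [Finite G] (A : SRing G) : Prop :=
  ∀ K : Subgroup (MulAut G),
    setOrbits (K : Set (MulAut G)) = setOrbits A.autGSet →
    (K : Set (MulAut G)) = A.autGSet

/-- `rad(X) = {g ∈ G : gX = Xg = X}`. -/
def rad {G : Type*} [Group G] (X : Set G) : Set G := {g | {g} * X = X ∧ X * {g} = X}

/-- The class `𝓔_c` of finite abelian groups all of whose Sylow subgroups are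
elementary abelian or isomorphic to `C₄`. -/
def InEc (G : Type*) [CommGroup G] [Finite G] : Prop :=
  ∀ p : ℕ, p.Prime → ∀ P : Sylow p G,
    (∀ x : ↥(P : Subgroup G), x ^ p = 1) ∨
    Nonempty (↥(P : Subgroup G) ≃* Multiplicative (ZMod 4))

/-- A finite group `G` is a `DCI`-group if any two Cayley digraphs over `G` that are
isomorphic as digraphs are Cayley isomorphic. -/
def IsDCIGroup (G : Type*) [Group G] : Prop :=
  ∀ S T : Set G,
    (∃ f : G ≃ G, ∀ g h : G, h * g⁻¹ ∈ S ↔ f h * (f g)⁻¹ ∈ T) →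
    ∃ φ : G ≃* G, ⇑φ '' S = T

/-- The subgroup `G_r ≤ Sym(G)` of right translations of `G`. -/
def rightTranslations (G : Type*) [Group G] : Subgroup (Equiv.Perm G) where
  carrier := Set.range fun g : G => Equiv.mulRight g
  one_mem' := ⟨1, by ext x; simp⟩
  mul_mem' := by
    rintro _ _ ⟨a, rfl⟩ ⟨b, rfl⟩
    exact ⟨b * a, by ext x; simp [mul_assoc]⟩
  inv_mem' := by
    rintro _ ⟨a, rfl⟩
    exact ⟨a⁻¹, by ext x; simp⟩

/-- The basic sets of the S-ring `V(K, G)`: the orbits of the stabilizer `K_e`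
of the identity on `G`. -/
def VBasic {G : Type*} [Group G] (K : Subgroup (Equiv.Perm G)) : Set (Set G) :=
  Set.range fun g : G => MulAction.orbit (MulAction.stabilizer K (1 : G)) g

/-- A subgroup `R ≤ Sym(G)` is regular if for all `g, h ∈ G` there is a
unique `r ∈ R` with `r(g) = h`. -/
def IsRegularSubgroup {G : Type*} [Group G] (R : Subgroup (Equiv.Perm G)) : Prop :=
  ∀ g h : G, ∃! r : R, (r : Equiv.Perm G) g = h

/-- `K ∈ Sup(G_r)`. -/
def InSup {G : Type*} [Group G] (K : Subgroup (Equiv.Perm G)) : Prop :=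
  rightTranslations G ≤ K

/-- `K ∈ Sup₂(G_r)`, i.e. `K ≥ G_r` and `K = K^{(2)} = Aut(V(K,G))`. -/
def InSup2 {G : Type*} [Group G] [Finite G] (K : Subgroup (Equiv.Perm G)) : Prop :=
  InSup K ∧
    (K : Set (Equiv.Perm G)) =
      {f : Equiv.Perm G | ∀ X ∈ VBasic K, Prod.map (⇑f) (⇑f) '' Rel X = Rel X}

/-- `K₁ ⪯_G K₂`: `K₁ ≤ K₂` and every regular subgroup of `K₂` isomorphic to `G`
is conjugate in `K₂` to a subgroup of `K₁`. -/
def GComplete {G : Type*} [Group G] (K₁ K₂ : Subgroup (Equiv.Perm G)) : Prop :=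
  K₁ ≤ K₂ ∧ ∀ R : Subgroup (Equiv.Perm G), R ≤ K₂ → IsRegularSubgroup R →
    Nonempty (↥R ≃* G) → ∃ k ∈ K₂, ∀ r ∈ R, k * r * k⁻¹ ∈ K₁

/-- `K ∈ Sup₂^min(G_r)`: a minimal element of `Sup₂(G_r)` with respect to `⪯_G`. -/
def InSup2Min {G : Type*} [Group G] [Finite G] (K : Subgroup (Equiv.Perm G)) : Prop :=
  InSup2 K ∧ ∀ K' : Subgroup (Equiv.Perm G), InSup2 K' → GComplete K' K → K' = K

/-- The basic sets of the restriction `𝒜_U` of `𝒜` to an `𝒜`-subgroup `U`: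
the basic sets of `𝒜` contained in `U`, viewed inside `U`. -/
def restrictBasic {G : Type*} [Group G] [Finite G] (A : SRing G) (U : Subgroup G) :
    Set (Set ↥U) :=
  {Y : Set ↥U | Subtype.val '' Y ∈ A.basic}

/-- The basic sets of the quotient S-ring `𝒜_{G/L}`: the images of the basic
sets of `𝒜` under the canonical epimorphism `G → G/L`. -/
def quotBasic {G : Type*} [CommGroup G] [Finite G] (A : SRing G) (L : Subgroup G) :
    Set (Set (G ⧸ L)) :=
  (fun X => QuotientGroup.mk '' X) '' A.basic

/-- The basic sets of the S-ring `𝒜_S` on the section `S = U/L`: the images under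
the canonical epimorphism `U → U/L` of the basic sets of `𝒜` contained in `U`. -/
def secBasic {G : Type*} [CommGroup G] [Finite G] (A : SRing G) (U L : Subgroup G) :
    Set (Set (↥U ⧸ L.subgroupOf U)) :=
  {Z | ∃ X ∈ A.basic, X ⊆ (U : Set G) ∧
    Z = QuotientGroup.mk '' (Subtype.val ⁻¹' X : Set ↥U)}

/-- The set of bijections of `H ⧸ N` induced by members of `Δ ⊆ Sym(H)`
permuting the `N`-cosets. -/
def inducedOnQuot {H : Type*} [CommGroup H] (N : Subgroup H) (Δ : Set (Equiv.Perm H)) :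
    Set (Equiv.Perm (H ⧸ N)) :=
  {σ | ∃ f ∈ Δ, ∀ x : H, σ (QuotientGroup.mk x) = QuotientGroup.mk (f x)}

/-- The canonical (injective) homomorphism `U/L → G/L` for `L ≤ U ≤ G`. -/
def secIncl {G : Type*} [CommGroup G] (U L : Subgroup G) :
    (↥U ⧸ L.subgroupOf U) →* G ⧸ L :=
  QuotientGroup.map (L.subgroupOf U) L U.subtype (fun _ hx => hx)

/-- The set of bijections of the section `S = U/L` induced by members of
`Δ ⊆ Sym(G/L)` preserving `S` (i.e. permuting the `L`-cosets contained in `U`). -/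
def inducedOnSec {G : Type*} [CommGroup G] (U L : Subgroup G)
    (Δ : Set (Equiv.Perm (G ⧸ L))) : Set (Equiv.Perm (↥U ⧸ L.subgroupOf U)) :=
  {σ | ∃ φ ∈ Δ, ∀ x : ↥U,
    φ (QuotientGroup.mk (x : G) : G ⧸ L) = secIncl U L (σ (QuotientGroup.mk x))}

/-- The basic sets of the S-ring `(ℤL ⊗ 𝒜_V) ≀_{(V×L)/V} ℤ(U/V)` over `U`,
where `Lu, V ≤ U` and `𝒜_V` is the restriction of `𝒜_U` to `V`. -/
def tensorWreathBasic {U : Type*} [CommGroup U] [Finite U] (AU : SRing U)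
    (Lu V : Subgroup U) : Set (Set U) :=
  {Z | (∃ l ∈ Lu, ∃ X ∈ AU.basic, X ⊆ (V : Set U) ∧ Z = l • X) ∨
       (∃ u : U, u ∉ Lu ⊔ V ∧ Z = u • (V : Set U))}

/-- Condition (CA): `𝒜_S = ℤS`. -/
def CondCA {G : Type*} [CommGroup G] [Finite G] (A : SRing G) (U L : Subgroup G) : Prop :=
  ∀ AS : SRing (↥U ⧸ L.subgroupOf U), AS.basic = secBasic A U L →
    AS.basic = Set.range fun s => ({s} : Set (↥U ⧸ L.subgroupOf U))

/-- Condition (CA'): `𝒜_U` or `𝒜_{G/L}` is cyclotomic and `𝒜_S` is Cayley minimal. -/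
def CondCA' {G : Type*} [CommGroup G] [Finite G] (A : SRing G) (U L : Subgroup G) : Prop :=
  ((∀ AU : SRing ↥U, AU.basic = restrictBasic A U → AU.IsCyclotomic) ∨
   (∀ AQ : SRing (G ⧸ L), AQ.basic = quotBasic A L → AQ.IsCyclotomic)) ∧
  (∀ AS : SRing (↥U ⧸ L.subgroupOf U), AS.basic = secBasic A U L → AS.IsCayleyMinimal)

/-- Condition (CA''): `U ≅ C_{4p}`, `L ≅ C₂` and
`𝒜_U = (ℤL ⊗ 𝒜_V) ≀_{(V×L)/V} ℤ(U/V)` for an `𝒜_U`-subgroup `V` of order `p`. -/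
def CondCA'' {G : Type*} [CommGroup G] [Finite G] (p : ℕ) (A : SRing G)
    (U L : Subgroup G) : Prop :=
  Nat.card ↥U = 4 * p ∧ IsCyclic ↥U ∧ Nat.card ↥L = 2 ∧
  ∀ AU : SRing ↥U, AU.basic = restrictBasic A U →
    ∃ V : Subgroup ↥U, AU.IsASubgroup V ∧ Nat.card ↥V = p ∧
      AU.basic = tensorWreathBasic AU (L.subgroupOf U) V

/-- `𝒜 = 𝒜_{G₁} ⊗ 𝒜_{G₂}` for `G = G₁ × G₂` (internally). -/
def IsTensorDecomp {G : Type*} [CommGroup G] [Finite G] (A : SRing G)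
    (G₁ G₂ : Subgroup G) : Prop :=
  A.IsASubgroup G₁ ∧ A.IsASubgroup G₂ ∧ G₁ ⊓ G₂ = ⊥ ∧ G₁ ⊔ G₂ = ⊤ ∧
  A.basic = {Z | ∃ X ∈ A.basic, ∃ Y ∈ A.basic,
    X ⊆ (G₁ : Set G) ∧ Y ⊆ (G₂ : Set G) ∧ Z = X * Y}

/-- `𝒜` is the tensor product of two S-rings over proper nontrivial subgroups of `G`. -/
def TensorConclusion {G : Type*} [CommGroup G] [Finite G] (A : SRing G) : Prop :=
  ∃ G₁ G₂ : Subgroup G, G₁ ≠ ⊥ ∧ G₁ ≠ ⊤ ∧ G₂ ≠ ⊥ ∧ G₂ ≠ ⊤ ∧ IsTensorDecomp A G₁ G₂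

/-- `𝒜` is a nontrivial `S = U/L`-wreath product satisfying one of the
conditions (CA), (CA'), (CA''). -/
def WreathConclusion {G : Type*} [CommGroup G] [Finite G] (p : ℕ) (A : SRing G) : Prop :=
  ∃ U L : Subgroup G, L ≤ U ∧ A.IsASubgroup U ∧ A.IsASubgroup L ∧ L ≠ ⊥ ∧ U ≠ ⊤ ∧
    (∀ X ∈ A.basic, ¬ X ⊆ (U : Set G) → (L : Set G) ⊆ rad X) ∧
    (CondCA A U L ∨ CondCA' A U L ∨ CondCA'' p A U L)


/-- The projections of an internal direct product `G = C × H` onto its factors, viewed as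
endomorphisms of `G`. -/
structure Splitting {G : Type*} [CommGroup G] (C H : Subgroup G) where
  fst : G →* G
  snd : G →* G
  fst_mem : ∀ x, fst x ∈ C
  snd_mem : ∀ x, snd x ∈ H
  fst_mul_snd : ∀ x, fst x * snd x = x
  fst_eq_one : ∀ x ∈ H, fst x = 1
  snd_eq_one : ∀ x ∈ C, snd x = 1

theorem exists_splitting {G : Type*} [CommGroup G] {C H : Subgroup G}
    (hinf : C ⊓ H = ⊥) (hsup : C ⊔ H = ⊤) : Nonempty (Splitting C H) := by
  have hbij : Function.Bijective (C.subtype.coprod H.subtype) := by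
    constructor
    · rw [injective_iff_map_eq_one]
      rintro ⟨⟨c, hc⟩, ⟨h, hh⟩⟩ hch
      have hch' : c * h = 1 := hch
      have hcH : c ∈ C ⊓ H :=
        ⟨hc, by rw [eq_inv_of_mul_eq_one_left hch']; exact H.inv_mem hh⟩
      rw [hinf, Subgroup.mem_bot] at hcH
      subst hcH
      simpa using hch'
    · intro g
      obtain ⟨c, hc, h, hh, rfl⟩ := Subgroup.mem_sup.1 (hsup ▸ Subgroup.mem_top g : g ∈ C ⊔ H)
      exact ⟨(⟨c, hc⟩, ⟨h, hh⟩), rfl⟩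
  let e := MulEquiv.ofBijective _ hbij
  have he : ∀ (c : C) (h : H), e.symm (c * h : G) = (c, h) := fun c h =>
    e.symm_apply_eq.2 rfl
  refine ⟨⟨C.subtype.comp ((MonoidHom.fst C H).comp e.symm.toMonoidHom),
    H.subtype.comp ((MonoidHom.snd C H).comp e.symm.toMonoidHom),
    fun x => (e.symm x).1.2, fun x => (e.symm x).2.2, fun x => e.apply_symm_apply x, ?_, ?_⟩⟩
  · intro x hx
    have := he 1 ⟨x, hx⟩
    simp only [OneMemClass.coe_one, one_mul] at this
    simp [this]
  · intro x hx
    have := he ⟨x, hx⟩ 1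
    simp only [OneMemClass.coe_one, mul_one] at this
    simp [this]

namespace Splitting

variable {G : Type*} [CommGroup G] {C H : Subgroup G} (P : Splitting C H)

theorem ext_proj {x y : G} (h₁ : P.fst x = P.fst y) (h₂ : P.snd x = P.snd y) : x = y := by
  rw [← P.fst_mul_snd x, ← P.fst_mul_snd y, h₁, h₂]

theorem fst_of_mem {x : G} (hx : x ∈ C) : P.fst x = x := by
  simpa [P.snd_eq_one x hx] using P.fst_mul_snd x

theorem snd_of_mem {x : G} (hx : x ∈ H) : P.snd x = x := by
  simpa [P.fst_eq_one x hx] using P.fst_mul_snd x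

theorem fst_eq_iff {x y : G} : P.fst x = P.fst y ↔ x * y⁻¹ ∈ H := by
  rw [← mul_inv_eq_one, ← map_inv, ← map_mul]
  refine ⟨fun h => ?_, P.fst_eq_one _⟩
  have := P.fst_mul_snd (x * y⁻¹)
  rw [h, one_mul] at this
  exact this ▸ P.snd_mem _

theorem snd_eq_iff {x y : G} : P.snd x = P.snd y ↔ x * y⁻¹ ∈ C := by
  rw [← mul_inv_eq_one, ← map_inv, ← map_mul]
  refine ⟨fun h => ?_, P.snd_eq_one _⟩
  have := P.fst_mul_snd (x * y⁻¹)
  rw [h, mul_one] at this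
  exact this ▸ P.fst_mem _

theorem fst_mul {x y : G} (hx : x ∈ C) (hy : y ∈ H) : P.fst (x * y) = x := by
  rw [map_mul, P.fst_of_mem hx, P.fst_eq_one y hy, mul_one]

theorem snd_mul {x y : G} (hx : x ∈ C) (hy : y ∈ H) : P.snd (x * y) = y := by
  rw [map_mul, P.snd_of_mem hy, P.snd_eq_one x hx, one_mul]

/-- A permutation group respects the splitting if it permutes the fibres of both projections,
i.e. the cosets of `H` and the cosets of `C`. -/
def Respects (K : Subgroup (Equiv.Perm G)) : Prop :=
  ∀ k ∈ K, ∀ x y, (P.fst (k x) = P.fst (k y) ↔ P.fst x = P.fst y) ∧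
    (P.snd (k x) = P.snd (k y) ↔ P.snd x = P.snd y)

end Splitting

theorem perm_apply_inv_self {α : Type*} (f : Equiv.Perm α) (x : α) : f (f⁻¹ x) = x :=
  f.apply_symm_apply x

/-- The subgroup of `K` consisting of the permutations preserving each fibre of `q`. -/
def fibreFixer {α β : Type*} (K : Subgroup (Equiv.Perm α)) (q : α → β) :
    Subgroup (Equiv.Perm α) where
  carrier := {k | k ∈ K ∧ ∀ x, q (k x) = q x}
  one_mem' := ⟨K.one_mem, fun _ => rfl⟩
  mul_mem' := by
    rintro f g ⟨hf, hf'⟩ ⟨hg, hg'⟩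
    exact ⟨K.mul_mem hf hg, fun x => by rw [Equiv.Perm.mul_apply, hf', hg']⟩
  inv_mem' := by
    rintro f ⟨hf, hf'⟩
    exact ⟨K.inv_mem hf, fun x => by rw [← hf' (f⁻¹ x), perm_apply_inv_self]⟩

namespace Splitting

variable {G : Type*} [CommGroup G] {C H : Subgroup G} (P : Splitting C H)
  {K : Subgroup (Equiv.Perm G)}

theorem commute_of_mem_fibreFixer (hK : P.Respects K) {f g : Equiv.Perm G}
    (hf : f ∈ fibreFixer K P.snd) (hg : g ∈ fibreFixer K P.fst) : f * g = g * f := by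
  ext x
  apply P.ext_proj
  · rw [Equiv.Perm.mul_apply, Equiv.Perm.mul_apply, hg.2]
    exact ((hK f hf.1 _ _).1).2 (hg.2 x)
  · rw [Equiv.Perm.mul_apply, Equiv.Perm.mul_apply, hf.2]
    exact (((hK g hg.1 _ _).2).2 (hf.2 x)).symm

/-- The internal direct product of the subgroups `K ∩ Sym(C)` and `K ∩ Sym(H)` of `K`. -/
def prodSubgroup (hK : P.Respects K) : Subgroup (Equiv.Perm G) where
  carrier := {k | ∃ f ∈ fibreFixer K P.snd, ∃ g ∈ fibreFixer K P.fst, k = f * g}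
  one_mem' := ⟨1, one_mem _, 1, one_mem _, by simp⟩
  mul_mem' := by
    rintro _ _ ⟨f, hf, g, hg, rfl⟩ ⟨f', hf', g', hg', rfl⟩
    refine ⟨f * f', mul_mem hf hf', g * g', mul_mem hg hg', ?_⟩
    rw [mul_assoc, ← mul_assoc g, ← P.commute_of_mem_fibreFixer hK hf' hg]
    simp only [mul_assoc]
  inv_mem' := by
    rintro _ ⟨f, hf, g, hg, rfl⟩
    refine ⟨f⁻¹, inv_mem hf, g⁻¹, inv_mem hg, ?_⟩
    rw [P.commute_of_mem_fibreFixer hK hf hg, mul_inv_rev]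

theorem prodSubgroup_le (hK : P.Respects K) : P.prodSubgroup hK ≤ K := by
  rintro _ ⟨f, hf, g, hg, rfl⟩
  exact K.mul_mem hf.1 hg.1

theorem rightTranslations_le_prodSubgroup (hK : P.Respects K) (hsup : InSup K) :
    InSup (P.prodSubgroup hK) := by
  rintro _ ⟨g, rfl⟩
  refine ⟨Equiv.mulRight (P.fst g), ⟨hsup ⟨_, rfl⟩, fun x => ?_⟩,
    Equiv.mulRight (P.snd g), ⟨hsup ⟨_, rfl⟩, fun x => ?_⟩, ?_⟩
  · simp [P.snd_eq_one _ (P.fst_mem g)]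
  · simp [P.fst_eq_one _ (P.snd_mem g)]
  · ext x
    simp only [Equiv.coe_mulRight, Equiv.Perm.mul_apply]
    rw [mul_assoc, mul_comm (P.snd g), P.fst_mul_snd]

/-- A regular abelian subgroup of `K` is contained in `(K ∩ Sym(C)) × (K ∩ Sym(H))`. -/
theorem regular_le_prodSubgroup (hK : P.Respects K) {R : Subgroup (Equiv.Perm G)}
    (hRK : R ≤ K) (hR : IsRegularSubgroup R) (hcomm : ∀ r ∈ R, ∀ s ∈ R, r * s = s * r) :
    R ≤ P.prodSubgroup hK := by
  intro r hr
  obtain ⟨⟨s, hs⟩, hs1, -⟩ := hR 1 (P.fst (r 1))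
  have htrans : ∀ x, ∃ t ∈ R, t 1 = x := fun x =>
    let ⟨t, ht, _⟩ := hR 1 x
    ⟨t, t.2, ht⟩
  simp only at hs1
  refine ⟨s, ⟨hRK hs, fun x => ?_⟩, s⁻¹ * r, ⟨hRK (mul_mem (inv_mem hs) hr), fun x => ?_⟩,
    by simp⟩
  · obtain ⟨t, ht, rfl⟩ := htrans x
    rw [← Equiv.Perm.mul_apply, hcomm s hs t ht, Equiv.Perm.mul_apply]
    refine ((hK t (hRK ht) _ _).2).2 ?_
    rw [hs1, P.snd_eq_one _ (P.fst_mem _), map_one]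
  · obtain ⟨t, ht, rfl⟩ := htrans x
    rw [← Equiv.Perm.mul_apply, hcomm _ (mul_mem (inv_mem hs) hr) t ht, Equiv.Perm.mul_apply]
    refine ((hK t (hRK ht) _ _).1).2 ?_
    refine ((hK s (hRK hs) _ _).1).1 ?_
    rw [Equiv.Perm.mul_apply, perm_apply_inv_self, hs1, P.fst_of_mem (P.fst_mem _)]

end Splitting

/-- Membership in the 2-closure of `K`, in terms of the action on ordered pairs. -/
theorem forall_image_rel_eq_iff {G : Type*} [Group G] {K : Subgroup (Equiv.Perm G)}
    (hK : InSup K) (f : Equiv.Perm G) :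
    (∀ X ∈ VBasic K, Prod.map (⇑f) (⇑f) '' Rel X = Rel X) ↔
      ∀ x y, ∃ k ∈ K, k x = f x ∧ k y = f y := by
  have hr : ∀ g : G, Equiv.mulRight g ∈ K := fun g => hK ⟨g, rfl⟩
  have hinv : ∀ k ∈ K, ∀ X ∈ VBasic K, ∀ x y, (x, y) ∈ Rel X → (k x, k y) ∈ Rel X := by
    rintro k hk _ ⟨g, rfl⟩ x y ⟨s, hs⟩
    have hs' : (s : Equiv.Perm G) g = y * x⁻¹ := hs
    have hmem : Equiv.mulRight (k x)⁻¹ * k * Equiv.mulRight x ∈ K :=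
      K.mul_mem (K.mul_mem (hr _) hk) (hr _)
    have hstab : (⟨_, hmem⟩ : K) ∈ MulAction.stabilizer K (1 : G) := by
      rw [MulAction.mem_stabilizer_iff]
      change (Equiv.mulRight (k x)⁻¹ * k * Equiv.mulRight x) 1 = 1
      simp
    refine ⟨⟨_, hstab⟩ * s, ?_⟩
    change (Equiv.mulRight (k x)⁻¹ * k * Equiv.mulRight x) ((s : Equiv.Perm G) g) = _
    rw [hs']
    simp
  constructor
  · intro hf x y
    have hxy : (x, y) ∈ Rel (MulAction.orbit (MulAction.stabilizer K (1 : G)) (y * x⁻¹)) :=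
      MulAction.mem_orbit_self (M := MulAction.stabilizer K (1 : G)) _
    have hfxy : (f x, f y) ∈ Rel (MulAction.orbit (MulAction.stabilizer K (1 : G)) (y * x⁻¹)) := by
      rw [← hf _ ⟨_, rfl⟩]
      exact ⟨_, hxy, rfl⟩
    obtain ⟨s, hs⟩ := hfxy
    have hs' : (s : Equiv.Perm G) (y * x⁻¹) = f y * (f x)⁻¹ := hs
    have hs1 : (s : Equiv.Perm G) 1 = 1 := s.2
    refine ⟨Equiv.mulRight (f x) * (s : Equiv.Perm G) * Equiv.mulRight x⁻¹,
      K.mul_mem (K.mul_mem (hr _) s.1.2) (hr _), ?_, ?_⟩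
    · simp [hs1]
    · simp [hs']
  · intro hf X hX
    ext ⟨u, v⟩
    constructor
    · rintro ⟨⟨x, y⟩, hxy, h⟩
      obtain ⟨k, hk, hkx, hky⟩ := hf x y
      rw [← h, Prod.map_apply, ← hkx, ← hky]
      exact hinv k hk X hX x y hxy
    · intro huv
      obtain ⟨k, hk, hkx, hky⟩ := hf (f⁻¹ u) (f⁻¹ v)
      rw [perm_apply_inv_self] at hkx hky
      refine ⟨(f⁻¹ u, f⁻¹ v), ?_, by simp⟩
      have := hinv k⁻¹ (K.inv_mem hk) X hX u v huv
      rwa [← Equiv.Perm.eq_inv_iff_eq.2 hkx, ← Equiv.Perm.eq_inv_iff_eq.2 hky] at this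

theorem inSup2_iff {G : Type*} [Group G] [Finite G] {K : Subgroup (Equiv.Perm G)} :
    InSup2 K ↔ InSup K ∧
      ∀ f : Equiv.Perm G, (∀ x y, ∃ k ∈ K, k x = f x ∧ k y = f y) → f ∈ K := by
  refine and_congr_right fun hK => ?_
  rw [Set.ext_iff]
  simp only [Set.mem_ofPred_eq, SetLike.mem_coe, forall_image_rel_eq_iff hK]
  exact ⟨fun h f => (h f).2, fun h f => ⟨fun hf x y => ⟨f, hf, rfl, rfl⟩, h f⟩⟩

namespace Splitting

variable {G : Type*} [CommGroup G] [Finite G] {C H : Subgroup G} (P : Splitting C H)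
  {K : Subgroup (Equiv.Perm G)}

theorem inSup2_prodSubgroup (hK : P.Respects K) (hK2 : InSup2 K) :
    InSup2 (P.prodSubgroup hK) := by
  obtain ⟨hsup, hcl⟩ := inSup2_iff.1 hK2
  refine inSup2_iff.2 ⟨P.rightTranslations_le_prodSubgroup hK hsup, fun f hf => ?_⟩
  have hfK : f ∈ K := hcl f fun x y =>
    let ⟨k, hk, h⟩ := hf x y
    ⟨k, P.prodSubgroup_le hK hk, h⟩
  have hinj : Function.Injective fun x => P.fst (f x) * P.snd x := by
    intro x y hxy
    simp only at hxy
    have h₁ := congrArg P.fst hxy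
    have h₂ := congrArg P.snd hxy
    rw [P.fst_mul (P.fst_mem _) (P.snd_mem _), P.fst_mul (P.fst_mem _) (P.snd_mem _)] at h₁
    rw [P.snd_mul (P.fst_mem _) (P.snd_mem _), P.snd_mul (P.fst_mem _) (P.snd_mem _)] at h₂
    exact P.ext_proj (((hK f hfK x y).1).1 h₁) h₂
  let φ : Equiv.Perm G := Equiv.ofBijective _ (Finite.injective_iff_bijective.1 hinj)
  have hφ : ∀ x, φ x = P.fst (f x) * P.snd x := fun _ => rfl
  have hfstφ : ∀ x, P.fst (φ x) = P.fst (f x) := fun x => by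
    rw [hφ, P.fst_mul (P.fst_mem _) (P.snd_mem _)]
  have hsndφ : ∀ x, P.snd (φ x) = P.snd x := fun x => by
    rw [hφ, P.snd_mul (P.fst_mem _) (P.snd_mem _)]
  have hφK : φ ∈ K := by
    refine hcl φ fun x y => ?_
    obtain ⟨_, ⟨k, hk, l, hl, rfl⟩, hx, hy⟩ := hf x y
    have key : ∀ z, (k * l) z = f z → k z = φ z := fun z hz => by
      apply P.ext_proj
      · rw [hfstφ, ← hz, Equiv.Perm.mul_apply]
        exact (((hK k hk.1 _ _).1).2 (hl.2 z)).symm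
      · rw [hk.2, hsndφ]
    exact ⟨k, hk.1, key x hx, key y hy⟩
  refine ⟨φ, ⟨hφK, hsndφ⟩, φ⁻¹ * f, ⟨K.mul_mem (K.inv_mem hφK) hfK, fun x => ?_⟩, by simp⟩
  refine ((hK f hfK _ _).1).1 ?_
  rw [← hfstφ, Equiv.Perm.mul_apply, perm_apply_inv_self]

theorem prodSubgroup_eq_of_minimal (hK : P.Respects K) (hmin : InSup2Min K) :
    P.prodSubgroup hK = K := by
  refine hmin.2 _ (P.inSup2_prodSubgroup hK hmin.1) ⟨P.prodSubgroup_le hK, ?_⟩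
  rintro R hRK hR ⟨e⟩
  refine ⟨1, K.one_mem, fun r hr => ?_⟩
  have hcomm : ∀ r ∈ R, ∀ s ∈ R, r * s = s * r := fun r hr s hs => by
    have : (⟨r, hr⟩ : R) * ⟨s, hs⟩ = ⟨s, hs⟩ * ⟨r, hr⟩ :=
      e.injective (by rw [map_mul, map_mul, mul_comm])
    exact congrArg Subtype.val this
  simpa using P.regular_le_prodSubgroup hK hRK hR hcomm hr

end Splitting

theorem coeff_sumElems {G : Type*} [Group G] [Finite G] (X : Set G) [DecidablePred (· ∈ X)]
    (x : G) : (sumElems X).coeff x = if x ∈ X then 1 else 0 := by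
  classical
  simp [sumElems, MonoidAlgebra.coeff_sum, Finsupp.single_apply]

/-- The coefficients of an element of an S-ring are constant on each basic set. -/
theorem SRing.coeff_eq_of_mem_span {G : Type*} [Group G] [Finite G] (A : SRing G)
    {a : MonoidAlgebra ℤ G} (ha : a ∈ A.span) {X : Set G} (hX : X ∈ A.basic) {x y : G}
    (hx : x ∈ X) (hy : y ∈ X) : a.coeff x = a.coeff y := by
  classical
  refine Submodule.span_induction (p := fun a _ => a.coeff x = a.coeff y) ?_ (by simp) ?_ ?_ ha
  · rintro _ ⟨Y, hY, rfl⟩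
    have key : ∀ z w, z ∈ X → w ∈ X → z ∈ Y → w ∈ Y := fun z w hz hw hzY =>
      (A.cover z).unique ⟨hX, hz⟩ ⟨hY, hzY⟩ ▸ hw
    have hiff : x ∈ Y ↔ y ∈ Y := ⟨key x y hx hy, key y x hy hx⟩
    simp only [coeff_sumElems, hiff]
  · intro a b _ _ ha hb
    simp [ha, hb]
  · intro n a _ ha
    rw [MonoidAlgebra.coeff_smul_apply, MonoidAlgebra.coeff_smul_apply, ha]

theorem SRing.IsASet.mem_iff {G : Type*} [Group G] [Finite G] {A : SRing G} {S : Set G}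
    (hS : A.IsASet S) {X : Set G} (hX : X ∈ A.basic) {x y : G} (hx : x ∈ X) (hy : y ∈ X) :
    x ∈ S ↔ y ∈ S := by
  classical
  have h := A.coeff_eq_of_mem_span hS hX hx hy
  rw [coeff_sumElems, coeff_sumElems] at h
  by_cases h₁ : x ∈ S <;> by_cases h₂ : y ∈ S <;> simp_all

theorem exists_vBasic_mem {G : Type*} [Group G] {K : Subgroup (Equiv.Perm G)} (hK : InSup K)
    {k : Equiv.Perm G} (hk : k ∈ K) (x y : G) :
    ∃ X ∈ VBasic K, x * y⁻¹ ∈ X ∧ k x * (k y)⁻¹ ∈ X := by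
  refine ⟨_, ⟨x * y⁻¹, rfl⟩, MulAction.mem_orbit_self (M := MulAction.stabilizer K (1 : G)) _, ?_⟩
  have h := (forall_image_rel_eq_iff hK k).2 (fun _ _ => ⟨k, hk, rfl, rfl⟩) _ ⟨x * y⁻¹, rfl⟩
  have hyx : (y, x) ∈ Rel (MulAction.orbit (MulAction.stabilizer K (1 : G)) (x * y⁻¹)) :=
    MulAction.mem_orbit_self (M := MulAction.stabilizer K (1 : G)) _
  have hk : (k y, k x) ∈ Rel (MulAction.orbit (MulAction.stabilizer K (1 : G)) (x * y⁻¹)) :=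
    h ▸ ⟨_, hyx, rfl⟩
  exact hk

theorem mem_orbit_stabilizer_iff {G : Type*} [Group G] {K : Subgroup (Equiv.Perm G)} {g z : G} :
    z ∈ MulAction.orbit (MulAction.stabilizer K (1 : G)) g ↔ ∃ k ∈ K, k 1 = 1 ∧ k g = z :=
  ⟨fun ⟨s, hs⟩ => ⟨s.1.1, s.1.2, s.2, hs⟩, fun ⟨k, hk, hk1, hkg⟩ => ⟨⟨⟨k, hk⟩, hk1⟩, hkg⟩⟩

namespace Splitting

variable {G : Type*} [CommGroup G] [Finite G] {C H : Subgroup G} (P : Splitting C H)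
  {K : Subgroup (Equiv.Perm G)}

theorem respects_of_isASubgroup (hK : InSup K) (A : SRing G) (hA : A.basic = VBasic K)
    (hC : A.IsASubgroup C) (hH : A.IsASubgroup H) : P.Respects K := by
  intro k hk x y
  obtain ⟨X, hX, hx, hy⟩ := exists_vBasic_mem hK hk x y
  rw [← hA] at hX
  rw [P.fst_eq_iff, P.fst_eq_iff, P.snd_eq_iff, P.snd_eq_iff]
  exact ⟨hH.mem_iff hX hy hx, hC.mem_iff hX hy hx⟩

theorem exists_mem_fst_snd (hK : P.Respects K) (hmin : InSup2Min K) {k l : Equiv.Perm G}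
    (hk : k ∈ K) (hl : l ∈ K) :
    ∃ m ∈ K, ∀ x, P.fst (m x) = P.fst (k x) ∧ P.snd (m x) = P.snd (l x) := by
  rw [← P.prodSubgroup_eq_of_minimal hK hmin] at hk hl
  obtain ⟨f, hf, g, hg, rfl⟩ := hk
  obtain ⟨f', hf', g', hg', rfl⟩ := hl
  refine ⟨f * g', K.mul_mem hf.1 hg'.1, fun x => ⟨?_, ?_⟩⟩
  · rw [Equiv.Perm.mul_apply, Equiv.Perm.mul_apply]
    exact ((hK f hf.1 _ _).1).2 ((hg'.2 x).trans (hg.2 x).symm)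
  · rw [Equiv.Perm.mul_apply, Equiv.Perm.mul_apply, hf.2, hf'.2]

theorem orbit_mul (hK : P.Respects K) (hmin : InSup2Min K) {c h : G} (hc : c ∈ C) (hh : h ∈ H) :
    MulAction.orbit (MulAction.stabilizer K (1 : G)) (c * h) =
      MulAction.orbit (MulAction.stabilizer K (1 : G)) c *
        MulAction.orbit (MulAction.stabilizer K (1 : G)) h := by
  have hfst : ∀ k ∈ K, k 1 = 1 → ∀ z ∈ H, P.fst (k z) = 1 := fun k hk hk1 z hz => by
    have := ((hK k hk z 1).1).2 (by rw [P.fst_eq_one z hz, map_one])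
    rwa [hk1, map_one] at this
  have hsnd : ∀ k ∈ K, k 1 = 1 → ∀ z ∈ C, P.snd (k z) = 1 := fun k hk hk1 z hz => by
    have := ((hK k hk z 1).2).2 (by rw [P.snd_eq_one z hz, map_one])
    rwa [hk1, map_one] at this
  have hfst' : ∀ k ∈ K, P.fst (k (c * h)) = P.fst (k c) := fun k hk =>
    ((hK k hk _ _).1).2 (by rw [P.fst_mul hc hh, P.fst_of_mem hc])
  have hsnd' : ∀ k ∈ K, P.snd (k (c * h)) = P.snd (k h) := fun k hk =>
    ((hK k hk _ _).2).2 (by rw [P.snd_mul hc hh, P.snd_of_mem hh])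
  ext z
  rw [Set.mem_mul]
  simp only [mem_orbit_stabilizer_iff]
  constructor
  · rintro ⟨k, hk, hk1, rfl⟩
    refine ⟨_, ⟨k, hk, hk1, rfl⟩, _, ⟨k, hk, hk1, rfl⟩, P.ext_proj ?_ ?_⟩
    · rw [map_mul, hfst k hk hk1 h hh, mul_one, hfst' k hk]
    · rw [map_mul, hsnd k hk hk1 c hc, one_mul, hsnd' k hk]
  · rintro ⟨_, ⟨k, hk, hk1, rfl⟩, _, ⟨l, hl, hl1, rfl⟩, rfl⟩
    obtain ⟨m, hm, hmx⟩ := P.exists_mem_fst_snd hK hmin hk hl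
    refine ⟨m, hm, P.ext_proj ?_ ?_, P.ext_proj ?_ ?_⟩
    · rw [(hmx 1).1, hk1]
    · rw [(hmx 1).2, hl1]
    · rw [(hmx _).1, map_mul P.fst, hfst l hl hl1 h hh, mul_one, hfst' k hk]
    · rw [(hmx _).2, map_mul P.snd, hsnd k hk hk1 c hc, one_mul, hsnd' l hl]

end Splitting

/-- If `C` and `H` are `𝒜`-subgroups for `𝒜 = V(K, G)` with `K` minimal, then
`𝒜 = 𝒜_C ⊗ 𝒜_H`. -/
theorem Splitting.basic_eq {G : Type*} [CommGroup G] [Finite G] {C H : Subgroup G}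
    (P : Splitting C H) {K : Subgroup (Equiv.Perm G)} (hmin : InSup2Min K) (A : SRing G) (hA : A.basic = VBasic K)
    (hC : A.IsASubgroup C) (hH : A.IsASubgroup H) :
    A.basic = {Z | ∃ X ∈ A.basic, ∃ Y ∈ A.basic,
      X ⊆ (C : Set G) ∧ Y ⊆ (H : Set G) ∧ Z = X * Y} := by
  have hK := P.respects_of_isASubgroup hmin.1.1 A hA hC hH
  have hself : ∀ g : G, g ∈ MulAction.orbit (MulAction.stabilizer K (1 : G)) g := fun g =>
    MulAction.mem_orbit_self g
  have hbasic : ∀ g : G, MulAction.orbit (MulAction.stabilizer K (1 : G)) g ∈ A.basic :=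
    fun g => hA ▸ ⟨g, rfl⟩
  ext Z
  constructor
  · intro hZ
    rw [hA] at hZ
    obtain ⟨g, rfl⟩ := hZ
    refine ⟨_, hbasic (P.fst g), _, hbasic (P.snd g),
      fun z hz => (hC.mem_iff (hbasic _) (hself _) hz).1 (P.fst_mem g),
      fun z hz => (hH.mem_iff (hbasic _) (hself _) hz).1 (P.snd_mem g), ?_⟩
    rw [← P.orbit_mul hK hmin (P.fst_mem g) (P.snd_mem g), P.fst_mul_snd]
  · rintro ⟨X, hX, Y, hY, hXC, hYH, rfl⟩
    rw [hA] at hX hY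
    obtain ⟨c, rfl⟩ := hX
    obtain ⟨h, rfl⟩ := hY
    exact P.orbit_mul hK hmin (hXC (hself c)) (hYH (hself h)) ▸ hbasic (c * h)

/-- Let `p` be an odd prime, `G = C × H` with `C ≅ C₄`,
`H ≅ C_p × C_p`, `K ∈ Sup₂^min(G_r)` and `𝒜 = V(K,G)`. If `C` and `H` are
`𝒜`-subgroups then `𝒜 = 𝒜_C ⊗ 𝒜_H`; in particular `𝒜` is the tensor product of
two S-rings over proper nontrivial subgroups of `G`. -/
theorem stmt13 (p : ℕ) (hp : p.Prime) (hodd : Odd p)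
    (G : Type*) [CommGroup G] [Finite G] (C H : Subgroup G)
    (hC : Nonempty (↥C ≃* Multiplicative (ZMod 4)))
    (hH : Nonempty (↥H ≃* Multiplicative (ZMod p) × Multiplicative (ZMod p)))
    (hinf : C ⊓ H = ⊥) (hsup : C ⊔ H = ⊤)
    (K : Subgroup (Equiv.Perm G)) (hK : InSup2Min K)
    (A : SRing G) (hA : A.basic = VBasic K)
    (hCA : A.IsASubgroup C) (hHA : A.IsASubgroup H) :
    (A.basic = {Z | ∃ X ∈ A.basic, ∃ Y ∈ A.basic,
        X ⊆ (C : Set G) ∧ Y ⊆ (H : Set G) ∧ Z = X * Y}) ∧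
    TensorConclusion A := by
  obtain ⟨P⟩ := exists_splitting hinf hsup
  have hbasic := P.basic_eq hK A hA hCA hHA
  obtain ⟨eC⟩ := hC
  obtain ⟨eH⟩ := hH
  have : Fact p.Prime := ⟨hp⟩
  have hC1 : C ≠ ⊥ := by
    rintro rfl
    have : Nontrivial (Multiplicative (ZMod 4)) := 
      have : Nontrivial (ZMod 4) := inferInstanceAs (Nontrivial (Fin 4))
      inferInstance
    exact not_subsingleton (Multiplicative (ZMod 4)) eC.symm.toEquiv.subsingleton
  have hH1 : H ≠ ⊥ := by
    rintro rfl
    exact not_subsingleton (Multiplicative (ZMod p) × Multiplicative (ZMod p))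
      eH.symm.toEquiv.subsingleton
  refine ⟨hbasic, C, H, hC1, ?_, hH1, ?_, hCA, hHA, hinf, hsup, hbasic⟩
  · rintro rfl
    exact hH1 (by rwa [top_inf_eq] at hinf)
  · rintro rfl
    exact hC1 (by rwa [inf_top_eq] at hinf)

end Paper
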